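/- arXiv:2512.15934 — 5 statements merged into one kernel-verified Lean document; each statement's English description precedes it below -/
import Mathlib

section
/- Lemma 1 (Transformer computes the Laplacian). Let Z₀ ∈ ℝ^{(d+n)×n} be the block matrix with top d×n block X (whose i-th column is x_i) and bottom n×n block equal to the identity I_n. Let W^Q = W^K be the (d+n)×(d+n) block-diagonal matrix with top-left block (1/σ)·I_d and all other blocks zero, and let W^V be the block-diagonal matrix with bottom-right block −I_n and all other blocks zero. Define the one-layer RBF-attention update Z₁ = Z₀ + W^V Z₀ κ_rbf(W^Q Z₀, W^K Z₀). Then the top d rows of Z₁ equal X and the bottom n rows of Z₁ equal the right-normalized Laplacian L̂ = I − A D^{−1}. -/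
open scoped BigOperators

/-- The RBF attention kernel: `[κ_rbf(U,V)]_{ij} = exp(−‖U^{(i)} − V^{(j)}‖²) /
∑_k exp(−‖U^{(k)} − V^{(j)}‖²)`, where `U^{(i)}` is the `i`-th column of `U` and the
squared Euclidean norm of a column difference is `∑ r, (U r i - V r j)^2`. -/
noncomputable def rbfKernel {ρ : Type*} [Fintype ρ] {n : ℕ}
    (U V : Matrix ρ (Fin n) ℝ) : Matrix (Fin n) (Fin n) ℝ :=
  fun i j =>
    Real.exp (-(∑ r, (U r i - V r j) ^ 2)) /
      ∑ k, Real.exp (-(∑ r, (U r k - V r j) ^ 2))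

/-- Lemma 1: with `Z₀` the block matrix with top block `X` and bottom
block `I_n`, `W^Q = W^K` block-diagonal with top-left block `(1/σ)·I_d`, `W^V`
block-diagonal with bottom-right block `−I_n`, the one-layer RBF attention update
`Z₁ = Z₀ + W^V Z₀ κ_rbf(W^Q Z₀, W^K Z₀)` has top `d` rows equal to `X` and bottom `n`
rows equal to the right-normalized Laplacian `L̂ = I − A D⁻¹`. -/
theorem stmt_2 (n d : ℕ) (hn : 1 ≤ n)
    (x : Fin n → EuclideanSpace ℝ (Fin d)) (σ : ℝ) (hσ : 0 < σ)
    (X : Matrix (Fin d) (Fin n) ℝ) (hX : ∀ r i, X r i = x i r)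
    (A D : Matrix (Fin n) (Fin n) ℝ)
    (hA : ∀ i j, A i j = Real.exp (-(‖x i - x j‖ ^ 2 / σ ^ 2)))
    (hD : D = Matrix.diagonal fun j => ∑ k, Real.exp (-(‖x k - x j‖ ^ 2 / σ ^ 2)))
    (Z₀ : Matrix (Fin d ⊕ Fin n) (Fin n) ℝ)
    (hZ₀ : Z₀ = Matrix.fromRows X (1 : Matrix (Fin n) (Fin n) ℝ))
    (WQ WK WV : Matrix (Fin d ⊕ Fin n) (Fin d ⊕ Fin n) ℝ)
    (hWQ : WQ = Matrix.fromBlocks (σ⁻¹ • (1 : Matrix (Fin d) (Fin d) ℝ)) 0 0 0)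
    (hWK : WK = WQ)
    (hWV : WV = Matrix.fromBlocks 0 0 0 (-(1 : Matrix (Fin n) (Fin n) ℝ)))
    (Z₁ : Matrix (Fin d ⊕ Fin n) (Fin n) ℝ)
    (hZ₁ : Z₁ = Z₀ + WV * Z₀ * rbfKernel (WQ * Z₀) (WK * Z₀)) :
    (∀ r i, Z₁ (Sum.inl r) i = X r i) ∧
      (∀ r i, Z₁ (Sum.inr r) i =
        ((1 : Matrix (Fin n) (Fin n) ℝ) - A * D⁻¹) r i) := by
  subst hWK
  have hs : ∀ i j, (∑ r, ((WK * Z₀) r i - (WK * Z₀) r j) ^ 2) = ‖x i - x j‖ ^ 2 / σ ^ 2 := by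
    intro i j
    rw [hWQ, hZ₀, Matrix.fromBlocks_mul_fromRows, EuclideanSpace.norm_sq_eq, Finset.sum_div,
      Fintype.sum_sum_type]
    simp only [Matrix.fromRows_apply_inl, Matrix.fromRows_apply_inr, Matrix.zero_mul, add_zero,
      Matrix.smul_mul, Matrix.one_mul, Matrix.smul_apply, Matrix.zero_apply, sub_self, hX,
      smul_eq_mul, Real.norm_eq_abs, sq_abs, PiLp.sub_apply]
    simp only [ne_eq, OfNat.ofNat_ne_zero, not_false_eq_true, zero_pow, Finset.sum_const_zero,
      add_zero]
    refine Finset.sum_congr rfl fun r _ => ?_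
    field_simp
  have hpos : ∀ j, 0 < ∑ k, Real.exp (-(‖x k - x j‖ ^ 2 / σ ^ 2)) := fun j =>
    Finset.sum_pos (fun k _ => Real.exp_pos _) ⟨j, Finset.mem_univ j⟩
  have hDi : D⁻¹ = Matrix.diagonal fun j => (∑ k, Real.exp (-(‖x k - x j‖ ^ 2 / σ ^ 2)))⁻¹ := by
    apply Matrix.inv_eq_right_inv
    rw [hD, Matrix.diagonal_mul_diagonal, ← Matrix.diagonal_one]
    congr 1
    funext j
    exact mul_inv_cancel₀ (hpos j).ne'
  have hK : rbfKernel (WK * Z₀) (WK * Z₀) = A * D⁻¹ := by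
    ext i j
    rw [hDi, Matrix.mul_diagonal, hA]
    simp only [rbfKernel, hs, div_eq_mul_inv]
  rw [hK] at hZ₁
  rw [hZ₁, hWV, hZ₀, Matrix.fromBlocks_mul_fromRows, Matrix.fromRows_mul]
  constructor
  · intro r i
    simp
  · intro r i
    simp [sub_eq_add_neg]
end

section
/- Power-iteration step of Lemma 2. Let Ψ ∈ ℝ^{n×n}, Φ ∈ ℝ^{k×n} and μ ∈ ℝ. Let Z ∈ ℝ^{(n+k)×n} be the block matrix with top n×n block Ψ and bottom k×n block Φ. Let W^Q = W^K be the (n+k)×(n+k) block-diagonal matrix with top-left block I_n and all other blocks zero, let W^V be the block-diagonal matrix with bottom-right block −I_k and all other blocks zero, and let W^S be the block-diagonal matrix with bottom-right block (μ−1)·I_k and all other blocks zero. Then the linear-attention update Z' = Z + W^V Z · (W^Q Z)ᵀ (W^K Z) + W^S Z is the block matrix with top n×n block Ψ and bottom k×n block Φ(μ·I − ΨᵀΨ). -/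
open scoped BigOperators
open Matrix

/-- power-iteration step of Lemma 2.  With `Z` the block matrix with top
block `Ψ` and bottom block `Φ`, `W^Q = W^K` block-diagonal with top-left block `I_n`,
`W^V` block-diagonal with bottom-right block `−I_k`, and `W^S` block-diagonal with
bottom-right block `(μ−1)·I_k`, the linear-attention update
`Z' = Z + W^V Z (W^Q Z)ᵀ (W^K Z) + W^S Z` is the block matrix with top block `Ψ` and
bottom block `Φ (μ·I − ΨᵀΨ)`. -/
theorem stmt_5 (n k : ℕ) (Ψ : Matrix (Fin n) (Fin n) ℝ)
    (Φ : Matrix (Fin k) (Fin n) ℝ) (μ : ℝ)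
    (Z : Matrix (Fin n ⊕ Fin k) (Fin n) ℝ) (hZ : Z = Matrix.fromRows Ψ Φ)
    (WQ WK WV WS : Matrix (Fin n ⊕ Fin k) (Fin n ⊕ Fin k) ℝ)
    (hWQ : WQ = Matrix.fromBlocks (1 : Matrix (Fin n) (Fin n) ℝ) 0 0 0)
    (hWK : WK = WQ)
    (hWV : WV = Matrix.fromBlocks 0 0 0 (-(1 : Matrix (Fin k) (Fin k) ℝ)))
    (hWS : WS = Matrix.fromBlocks 0 0 0 ((μ - 1) • (1 : Matrix (Fin k) (Fin k) ℝ)))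
    (Z' : Matrix (Fin n ⊕ Fin k) (Fin n) ℝ)
    (hZ' : Z' = Z + WV * Z * ((WQ * Z)ᵀ * (WK * Z)) + WS * Z) :
    Z' = Matrix.fromRows Ψ
      (Φ * (μ • (1 : Matrix (Fin n) (Fin n) ℝ) - Ψᵀ * Ψ)) := by
  have hb : ∀ (A : Matrix (Fin n) (Fin n) ℝ) (D : Matrix (Fin k) (Fin k) ℝ),
      Matrix.fromBlocks A 0 0 D * Matrix.fromRows Ψ Φ
        = Matrix.fromRows (A * Ψ) (D * Φ) := by
    intro A D
    rw [Matrix.fromBlocks_mul_fromRows]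
    simp
  have h0 : (Matrix.fromRows Ψ (0 : Matrix (Fin k) (Fin n) ℝ))ᵀ
      * Matrix.fromRows Ψ (0 : Matrix (Fin k) (Fin n) ℝ) = Ψᵀ * Ψ := by
    rw [Matrix.transpose_fromRows, Matrix.fromCols_mul_fromRows]
    simp
  subst hZ' hWK hWQ hWV hWS hZ
  rw [hb, hb, hb, Matrix.one_mul, Matrix.zero_mul, Matrix.zero_mul, h0, Matrix.fromRows_mul]
  ext i j
  rcases i with i | i
  · simp
  · simp [Matrix.mul_sub, Matrix.mul_assoc]
    ring
end

section
/- Theorem 1 (geodesic distance on a product, lower bound, metric form). Let k ≥ 1, let (X_1,…,X_k) be metric spaces, and endow the product Π_i X_i with the ℓ² product distance d((p_1,…,p_k),(q_1,…,q_k)) = sqrt(Σ_{i=1}^k d_{X_i}(p_i,q_i)²). For any function c : ℝ → Π_i X_i and any set s ⊆ ℝ, the total variation of c on s is at least the ℓ² combination of the componentwise total variations: eVariationOn(c, s) ≥ ( Σ_{i=1}^k eVariationOn(c_i, s)² )^{1/2}, where c_i is the i-th component of c and the inequality is in the extended nonnegative reals. -/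
open scoped BigOperators ENNReal

lemma aux_iSup {E : Type*} [PseudoEMetricSpace E] (f : ℝ → E) (s : Set ℝ) :
    eVariationOn f s = ⨆ F : {F : Finset ℝ // (F : Set ℝ) ⊆ s}, eVariationOn f (F.1 : Set ℝ) := by
  apply le_antisymm
  · rw [eVariationOn]
    refine iSup_le ?_
    rintro ⟨n, u, hu, hs⟩
    have hF : ((((Finset.Iic n).image u : Finset ℝ)) : Set ℝ) = u '' Set.Iic n := by simp
    refine le_iSup_of_le ⟨(Finset.Iic n).image u, ?_⟩ ?_
    · rw [hF]; rintro _ ⟨i, -, rfl⟩; exact hs i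
    · show _ ≤ eVariationOn f (((Finset.Iic n).image u : Finset ℝ) : Set ℝ)
      rw [hF, eVariationOn.image_range_of_monotone f hu n]
      exact le_of_eq (Finset.sum_congr rfl fun i _ => edist_comm _ _)
  · exact iSup_le fun F => eVariationOn.mono f F.2

lemma aux_enum (s : Finset ℝ) (hne : s.Nonempty) :
    ∃ (u : ℕ → ℝ) (n : ℕ), Monotone u ∧ (s : Set ℝ) = u '' Set.Iic n := by
  have := s.card_pos.2 hne
  let u : ℕ → ℝ := fun n ↦ s.orderEmbOfFin rfl ⟨min n (s.card - 1), by grind⟩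
  refine ⟨u, s.card - 1, fun _ _ _ ↦ OrderEmbedding.monotone _ (by grind), ?_⟩
  ext
  simp only [← s.range_orderEmbOfFin rfl, Set.mem_image, Set.mem_Iic, Set.mem_range, u]
  constructor
  · rintro ⟨i, rfl⟩; exact ⟨i.val, by grind⟩
  · rintro ⟨i, hi, rfl⟩; use ⟨i, by omega⟩; congr; omega

lemma aux_mink {k : ℕ} (a : ℕ → Fin k → ℝ≥0∞) (n : ℕ) :
    (∑ i, (∑ j ∈ Finset.range n, a j i) ^ (2 : ℝ)) ^ ((1 : ℝ) / 2) ≤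
      ∑ j ∈ Finset.range n, (∑ i, a j i ^ (2 : ℝ)) ^ ((1 : ℝ) / 2) := by
  induction n with
  | zero => simp
  | succ n ih =>
    simp only [Finset.sum_range_succ]
    exact (ENNReal.Lp_add_le _ _ _ (by norm_num)).trans (by gcongr)

/-- Theorem 1, lower bound, metric form.  For a curve `c` into the ℓ²
product `PiLp 2 X` of metric spaces and any set `s ⊆ ℝ`, the total variation of `c`
on `s` is at least the ℓ² combination of the componentwise total variations. -/
theorem stmt_9 (k : ℕ) (hk : 1 ≤ k) (X : Fin k → Type*)
    [∀ i, MetricSpace (X i)]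
    (c : ℝ → PiLp 2 X) (s : Set ℝ) :
    (∑ i, eVariationOn (fun t => (WithLp.equiv 2 (∀ i, X i)) (c t) i) s ^ 2)
        ^ ((1 : ℝ) / 2) ≤
      eVariationOn c s := by
  have key : ∀ i, eVariationOn (fun t => (WithLp.equiv 2 (∀ i, X i)) (c t) i) s ^ 2 =
      ⨆ F : {F : Finset ℝ // (F : Set ℝ) ⊆ s},
        eVariationOn (fun t => (WithLp.equiv 2 (∀ i, X i)) (c t) i) (F.1 : Set ℝ) ^ (2 : ℝ) := by
    intro i
    rw [aux_iSup, ← ENNReal.rpow_two]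
    exact (ENNReal.orderIsoRpow 2 (by norm_num)).map_iSup _
  simp only [key]
  rw [ENNReal.finsetSum_iSup]
  · rw [show ∀ g : {F : Finset ℝ // (F : Set ℝ) ⊆ s} → ℝ≥0∞,
      (⨆ F, g F) ^ ((1 : ℝ) / 2) = ⨆ F, g F ^ ((1 : ℝ) / 2) from
      fun g => (ENNReal.orderIsoRpow (1 / 2) (by norm_num)).map_iSup g]
    refine iSup_le fun F => ?_
    refine le_trans ?_ (eVariationOn.mono c F.2)
    obtain ⟨F, hF⟩ := F
    rcases F.eq_empty_or_nonempty with rfl | hne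
    · simp
    obtain ⟨u, n, hu, h⟩ := aux_enum F hne
    simp only [h, eVariationOn.image_range_of_monotone _ hu]
    refine (aux_mink _ n).trans (le_of_eq ?_)
    refine Finset.sum_congr rfl fun j _ => ?_
    rw [PiLp.edist_eq_sum (by norm_num)]
    simp
  · intro F G
    classical
    refine ⟨⟨F.1 ∪ G.1, by simpa using ⟨F.2, G.2⟩⟩, fun i => ⟨?_, ?_⟩⟩
    · exact ENNReal.rpow_le_rpow (eVariationOn.mono _ (by simp)) (by norm_num)
    · exact ENNReal.rpow_le_rpow (eVariationOn.mono _ (by simp)) (by norm_num)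
end

section
/- Theorem 1 (product of length spaces is a length space with ℓ² distance). Let X and Y be metric spaces such that for all points p, q in the same space, the distance equals the infimum, over continuous curves γ : [0,1] → X (resp. Y) with γ(0) = p and γ(1) = q, of the total variation eVariationOn(γ, [0,1]). Endow X × Y with the ℓ² product distance d((p_1,p_2),(q_1,q_2)) = sqrt(d_X(p_1,q_1)² + d_Y(p_2,q_2)²). Then for all (p_1,p_2), (q_1,q_2) ∈ X × Y, the infimum over continuous curves c : [0,1] → X × Y with c(0) = (p_1,p_2) and c(1) = (q_1,q_2) of eVariationOn(c, [0,1]) equals sqrt(d_X(p_1,q_1)² + d_Y(p_2,q_2)²). -/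
open scoped BigOperators ENNReal

open Set Filter Topology in
theorem aux_lip {X : Type*} [MetricSpace X] (γ : ℝ → X) (hc : ContinuousOn γ (Icc 0 1))
    (K : ℝ) (hK : eVariationOn γ (Icc 0 1) ≤ ENNReal.ofReal K) (hK0 : 0 ≤ K) :
    ∃ g : ℝ → X, g 0 = γ 0 ∧ g 1 = γ 1 ∧
      ∀ s ∈ Icc (0:ℝ) 1, ∀ t ∈ Icc (0:ℝ) 1, dist (g s) (g t) ≤ K * |s - t| := by
  set I : Set ℝ := Icc 0 1 with hI
  have h0 : (0:ℝ) ∈ I := by simp [hI]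
  have h1 : (1:ℝ) ∈ I := by simp [hI]
  have hbv : BoundedVariationOn γ I := ne_top_of_le_ne_top ENNReal.ofReal_ne_top hK
  have hl := hbv.locallyBoundedVariationOn
  set V := variationOnFromTo γ I 0 with hV
  have hsub : ∀ x ∈ I, ∀ y ∈ I, x ≤ y →
      V y - V x = (eVariationOn γ (I ∩ Icc x y)).toReal := by
    intro x hx y hy hxy
    rw [← variationOnFromTo.eq_of_le γ I hxy]
    have := variationOnFromTo.add hl h0 hx hy
    simp only [hV]
    linarith
  have hdist' : ∀ x ∈ I, ∀ y ∈ I, x ≤ y → dist (γ x) (γ y) ≤ |V x - V y| := by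
    intro x hx y hy hxy
    rw [abs_sub_comm, hsub x hx y hy hxy, abs_of_nonneg ENNReal.toReal_nonneg, dist_edist]
    refine ENNReal.toReal_mono (hl x y hx hy) ?_
    exact eVariationOn.edist_le γ ⟨hx, le_rfl, hxy⟩ ⟨hy, hxy, le_rfl⟩
  have hdist : ∀ x ∈ I, ∀ y ∈ I, dist (γ x) (γ y) ≤ |V x - V y| := by
    intro x hx y hy
    rcases le_total x y with h | h
    · exact hdist' x hx y hy h
    · rw [dist_comm, abs_sub_comm]; exact hdist' y hy x hx h
  have hVc : ContinuousOn V I := by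
    intro x hx
    have a1 := hbv.tendsto_eVariationOn_Icc_zero_left ((hc x hx).mono inter_subset_left)
    have a2 := hbv.tendsto_eVariationOn_Icc_zero_right x ((hc x hx).mono inter_subset_left)
    have b1 := (ENNReal.tendsto_toReal ENNReal.zero_ne_top).comp a1
    have b2 := (ENNReal.tendsto_toReal ENNReal.zero_ne_top).comp a2
    have b3 := b1.add b2
    simp only [ENNReal.toReal_zero, add_zero] at b3
    rw [ContinuousWithinAt, tendsto_iff_dist_tendsto_zero]
    refine squeeze_zero' (Eventually.of_forall fun _ => dist_nonneg) ?_ b3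
    filter_upwards [self_mem_nhdsWithin] with y hy
    simp only [Function.comp, Real.dist_eq]
    rcases le_total x y with h | h
    · rw [hsub x hx y hy h, abs_of_nonneg ENNReal.toReal_nonneg]
      exact le_add_of_nonneg_left ENNReal.toReal_nonneg
    · rw [abs_sub_comm, hsub y hy x hx h, abs_of_nonneg ENNReal.toReal_nonneg]
      exact le_add_of_nonneg_right ENNReal.toReal_nonneg
  have hV0 : V 0 = 0 := variationOnFromTo.self γ I 0
  have hV1 : 0 ≤ V 1 := variationOnFromTo.nonneg_of_le γ I zero_le_one
  have hV1K : V 1 ≤ K := by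
    rw [hV, variationOnFromTo.eq_of_le γ I zero_le_one]
    refine ENNReal.toReal_le_of_le_ofReal hK0 ?_
    rwa [hI, inter_self]
  have key : ∀ s : ℝ, ∃ t, s ∈ I → t ∈ I ∧ V t = s * V 1 := by
    intro s
    by_cases hs : s ∈ I
    · have := intermediate_value_Icc (zero_le_one' ℝ) hVc
      have hm : s * V 1 ∈ Icc (V 0) (V 1) := by
        rw [hV0]
        exact ⟨mul_nonneg hs.1 hV1, mul_le_of_le_one_left hV1 hs.2⟩
      obtain ⟨t, ht, h⟩ := this hm
      exact ⟨t, fun _ => ⟨ht, h⟩⟩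
    · exact ⟨0, fun h => absurd h hs⟩
  choose τ hτ using key
  refine ⟨fun s => γ (τ s), ?_, ?_, ?_⟩
  · have := hdist _ (hτ 0 h0).1 _ h0
    rw [(hτ 0 h0).2, hV0] at this
    simpa using this
  · have := hdist _ (hτ 1 h1).1 _ h1
    rw [(hτ 1 h1).2] at this
    simpa using this
  · intro s hs t ht
    refine (hdist _ (hτ s hs).1 _ (hτ t ht).1).trans ?_
    rw [(hτ s hs).2, (hτ t ht).2, ← sub_mul, abs_mul, abs_of_nonneg hV1, mul_comm]
    exact mul_le_mul_of_nonneg_right hV1K (abs_nonneg _)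

theorem aux_ex {X : Type*} [MetricSpace X] (p q : X)
    (h : ENNReal.ofReal (dist p q) =
      ⨅ (γ : ℝ → X) (_ : ContinuousOn γ (Set.Icc 0 1)) (_ : γ 0 = p) (_ : γ 1 = q),
        eVariationOn γ (Set.Icc 0 1)) (ε : ℝ) (hε : 0 < ε) :
    ∃ g : ℝ → X, g 0 = p ∧ g 1 = q ∧ ∀ s ∈ Set.Icc (0:ℝ) 1, ∀ t ∈ Set.Icc (0:ℝ) 1,
      dist (g s) (g t) ≤ (dist p q + ε) * |s - t| := by
  have hlt : ENNReal.ofReal (dist p q) < ENNReal.ofReal (dist p q + ε) :=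
    (ENNReal.ofReal_lt_ofReal_iff (by positivity)).2 (by linarith)
  rw [h] at hlt
  simp only [iInf_lt_iff] at hlt
  obtain ⟨γ, hc, h0, h1, hv⟩ := hlt
  obtain ⟨g, g0, g1, hg⟩ := aux_lip γ hc (dist p q + ε) hv.le (by positivity)
  exact ⟨g, g0.trans h0, g1.trans h1, hg⟩

theorem aux_dist {X Y : Type*} [MetricSpace X] [MetricSpace Y] (p q : WithLp 2 (X × Y)) :
    dist p q = Real.sqrt (dist p.fst q.fst ^ 2 + dist p.snd q.snd ^ 2) := by
  rw [WithLp.prod_dist_eq_add (by norm_num), Real.sqrt_eq_rpow]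
  norm_num

/-- Theorem 1: the ℓ² product of two length spaces is a length space.
If in `X` and in `Y` the distance between any two points equals the infimum of the
total variation over continuous curves on `[0,1]` joining them, then the same holds
in the ℓ² product `WithLp 2 (X × Y)`, whose distance is
`sqrt (dist² + dist²)`. -/
theorem stmt_13 (X Y : Type*) [MetricSpace X] [MetricSpace Y]
    (hX : ∀ p q : X, ENNReal.ofReal (dist p q) =
      ⨅ (γ : ℝ → X) (_ : ContinuousOn γ (Set.Icc 0 1)) (_ : γ 0 = p) (_ : γ 1 = q),
        eVariationOn γ (Set.Icc 0 1))
    (hY : ∀ p q : Y, ENNReal.ofReal (dist p q) =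
      ⨅ (γ : ℝ → Y) (_ : ContinuousOn γ (Set.Icc 0 1)) (_ : γ 0 = p) (_ : γ 1 = q),
        eVariationOn γ (Set.Icc 0 1)) :
    ∀ p q : WithLp 2 (X × Y),
      (⨅ (c : ℝ → WithLp 2 (X × Y)) (_ : ContinuousOn c (Set.Icc 0 1))
          (_ : c 0 = p) (_ : c 1 = q), eVariationOn c (Set.Icc 0 1)) =
        ENNReal.ofReal (dist p q) ∧
      dist p q = Real.sqrt
        (dist (WithLp.equiv 2 (X × Y) p).1 (WithLp.equiv 2 (X × Y) q).1 ^ 2 +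
          dist (WithLp.equiv 2 (X × Y) p).2 (WithLp.equiv 2 (X × Y) q).2 ^ 2) := by
  intro p q
  refine ⟨le_antisymm ?_ ?_, aux_dist p q⟩
  · have hb : ∀ ε : ℝ, 0 < ε →
        (⨅ (c : ℝ → WithLp 2 (X × Y)) (_ : ContinuousOn c (Set.Icc 0 1))
          (_ : c 0 = p) (_ : c 1 = q), eVariationOn c (Set.Icc 0 1)) ≤
        ENNReal.ofReal (Real.sqrt ((dist p.fst q.fst + ε) ^ 2 + (dist p.snd q.snd + ε) ^ 2)) := by
      intro ε hε
      obtain ⟨f, f0, f1, hf⟩ := aux_ex p.fst q.fst (hX _ _) ε hε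
      obtain ⟨g, g0, g1, hg⟩ := aux_ex p.snd q.snd (hY _ _) ε hε
      set K := Real.sqrt ((dist p.fst q.fst + ε) ^ 2 + (dist p.snd q.snd + ε) ^ 2) with hK
      have hlip : LipschitzOnWith K.toNNReal
          (fun s => (WithLp.toLp 2 (f s, g s) : WithLp 2 (X × Y))) (Set.Icc 0 1) := by
        refine LipschitzOnWith.of_dist_le_mul fun s hs t ht => ?_
        rw [aux_dist, Real.coe_toNNReal _ (Real.sqrt_nonneg _), Real.dist_eq]
        refine Real.sqrt_le_iff.2 ⟨by positivity, ?_⟩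
        rw [mul_pow, Real.sq_sqrt (by positivity), add_mul, ← mul_pow, ← mul_pow]
        have := hf s hs t ht
        have := hg s hs t ht
        simp only [WithLp.toLp_fst, WithLp.toLp_snd]
        gcongr
      refine iInf_le_of_le _ (iInf_le_of_le hlip.continuousOn (iInf_le_of_le ?_ (iInf_le_of_le ?_ ?_)))
      · simp only [f0, g0]; rfl
      · simp only [f1, g1]; rfl
      · have := hlip.comp_eVariationOn_le (g := id) (Set.mapsTo_id _)
        rw [eVariationOn_id_Icc] at this
        simpa [ENNReal.ofReal] using this
    have ht : Filter.Tendsto (fun ε : ℝ => ENNReal.ofReal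
        (Real.sqrt ((dist p.fst q.fst + ε) ^ 2 + (dist p.snd q.snd + ε) ^ 2)))
        (nhdsWithin 0 (Set.Ioi 0)) (nhds (ENNReal.ofReal (dist p q))) := by
      have hc : Continuous (fun ε : ℝ => ENNReal.ofReal
        (Real.sqrt ((dist p.fst q.fst + ε) ^ 2 + (dist p.snd q.snd + ε) ^ 2))) :=
        ENNReal.continuous_ofReal.comp (by fun_prop)
      have := (hc.tendsto 0).mono_left (nhdsWithin_le_nhds (s := Set.Ioi 0))
      simpa [aux_dist p q] using this
    refine ge_of_tendsto ht ?_
    filter_upwards [self_mem_nhdsWithin] with ε hε using hb ε hε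
  · refine le_iInf fun c => le_iInf fun _ => le_iInf fun h0 => le_iInf fun h1 => ?_
    rw [← edist_dist, ← h0, ← h1]
    exact eVariationOn.edist_le c (by simp) (by simp)
end

section
/- Great-circle distance on the sphere. Let p and q be unit vectors in three-dimensional Euclidean space ℝ³. Then the infimum, over continuous curves γ : [0,1] → S² (the unit sphere {x ∈ ℝ³ : ‖x‖ = 1}) with γ(0) = p and γ(1) = q, of the total variation eVariationOn(γ, [0,1]), equals arccos(⟨p, q⟩). -/
open scoped BigOperators ENNReal RealInnerProductSpace

abbrev E3 := EuclideanSpace ℝ (Fin 3)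

lemma dist_sq_unit (x y : E3) (hx : ‖x‖ = 1) (hy : ‖y‖ = 1) :
    ‖x - y‖ = 2 * Real.sin (InnerProductGeometry.angle x y / 2) := by
  have h0 := InnerProductGeometry.angle_nonneg x y
  have h1 := InnerProductGeometry.angle_le_pi x y
  have hs : 0 ≤ Real.sin (InnerProductGeometry.angle x y / 2) :=
    Real.sin_nonneg_of_nonneg_of_le_pi (by linarith) (by linarith [Real.pi_pos])
  rw [← sq_eq_sq₀ (norm_nonneg _) (by positivity)]
  have h2 := InnerProductGeometry.norm_sub_sq_eq_norm_sq_add_norm_sq_sub_two_mul_norm_mul_norm_mul_cos_angle x y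
  have h3 : Real.cos (InnerProductGeometry.angle x y)
      = 1 - 2 * Real.sin (InnerProductGeometry.angle x y / 2) ^ 2 := by
    have := Real.cos_two_mul' (InnerProductGeometry.angle x y / 2)
    rw [mul_div_cancel₀ _ (two_ne_zero)] at this
    have h4 := Real.sin_sq_add_cos_sq (InnerProductGeometry.angle x y / 2)
    linarith
  rw [hx, hy, h3] at h2
  nlinarith

lemma angle_local (x y : E3) (hx : ‖x‖ = 1) (hy : ‖y‖ = 1) (ε : ℝ) (hε : 0 < ε) (hε1 : ε ≤ 1)
    (h : ‖x - y‖ ≤ ε) : (1 - ε) * InnerProductGeometry.angle x y ≤ ‖x - y‖ := by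
  have h0 := InnerProductGeometry.angle_nonneg x y
  have h1 := InnerProductGeometry.angle_le_pi x y
  have hd := dist_sq_unit x y hx hy
  set u := InnerProductGeometry.angle x y / 2 with hu
  have ha : InnerProductGeometry.angle x y = 2 * u := by rw [hu]; ring
  rw [ha] at h0 h1 ⊢
  have hu0 : 0 ≤ u := by linarith
  have hj := Real.mul_le_sin hu0 (by linarith)
  have hule : u ≤ ε := by
    have hp := Real.pi_lt_four
    have hp0 := Real.pi_pos
    have : 1 / 2 * u ≤ 2 / Real.pi * u := by
      apply mul_le_mul_of_nonneg_right _ hu0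
      rw [div_le_div_iff₀ (by norm_num) hp0]; linarith
    linarith
  rcases hu0.eq_or_lt with h' | h'
  · rw [← h']; simp
  have hc := Real.sin_gt_sub_cube h'
  rw [hd]
  have : u ^ 3 ≤ ε * u := by
    have : u ^ 2 ≤ ε := by nlinarith
    nlinarith
  nlinarith

lemma angle_le_sum (f : ℕ → E3) (hf : ∀ i, ‖f i‖ = 1) (n : ℕ) :
    InnerProductGeometry.angle (f 0) (f n) ≤
      ∑ i ∈ Finset.range n, InnerProductGeometry.angle (f (i + 1)) (f i) := by
  induction n with
  | zero =>
    have : f 0 ≠ 0 := by intro h; have := hf 0; rw [h] at this; simp at this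
    simp [InnerProductGeometry.angle_self this]
  | succ n ih =>
    rw [Finset.sum_range_succ, InnerProductGeometry.angle_comm (f (n+1))]
    exact (InnerProductGeometry.angle_le_angle_add_angle _ (f n) _).trans (by linarith)

lemma lower (γ : ℝ → Metric.sphere (0 : E3) 1) (hγ : ContinuousOn γ (Set.Icc 0 1)) :
    ENNReal.ofReal (InnerProductGeometry.angle (γ 0 : E3) (γ 1)) ≤ eVariationOn γ (Set.Icc 0 1) := by
  by_cases hV : eVariationOn γ (Set.Icc 0 1) = ⊤
  · rw [hV]; exact le_top
  rw [ENNReal.ofReal_le_iff_le_toReal hV]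
  have hn : ∀ t, ‖(γ t : E3)‖ = 1 := fun t => by simpa using (γ t).2
  have key : ∀ ε : ℝ, 0 < ε → ε ≤ 1 →
      (1 - ε) * InnerProductGeometry.angle (γ 0 : E3) (γ 1) ≤ (eVariationOn γ (Set.Icc 0 1)).toReal := by
    intro ε hε hε1
    have huc := isCompact_Icc.uniformContinuousOn_of_continuous hγ
    rw [Metric.uniformContinuousOn_iff] at huc
    obtain ⟨δ, hδ, H⟩ := huc ε hε
    obtain ⟨n, hnδ⟩ := exists_nat_one_div_lt hδ
    have hN : (0 : ℝ) < n + 1 := by positivity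
    let u : ℕ → ℝ := fun i => min (i / (n + 1 : ℝ)) 1
    have hu : Monotone u := by
      intro i j hij
      apply min_le_min_right
      gcongr
    have hus : ∀ i, u i ∈ Set.Icc (0 : ℝ) 1 := fun i =>
      ⟨le_min (by positivity) zero_le_one, min_le_right _ _⟩
    have hstep : ∀ i, dist (u (i + 1)) (u i) < δ := by
      intro i
      refine lt_of_le_of_lt ?_ hnδ
      have e : ((i + 1 : ℕ) : ℝ) / (n + 1) - i / (n + 1) = 1 / (n + 1) := by
        push_cast; field_simp; ring
      rw [Real.dist_eq, abs_of_nonneg (sub_nonneg.2 (hu (Nat.le_succ i)))]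
      have hp : 0 < 1 / (n + 1 : ℝ) := by positivity
      simp only [u]
      rcases min_cases ((i : ℝ) / (n + 1)) 1 with h | h <;>
      linarith [min_le_left (((i + 1 : ℕ) : ℝ) / (n + 1)) 1, min_le_right (((i + 1 : ℕ) : ℝ) / (n + 1)) 1]
    have hs := eVariationOn.sum_le (f := γ) (n := n + 1) hu hus
    have hs2 : ∑ i ∈ Finset.range (n + 1), ‖(γ (u (i+1)) : E3) - γ (u i)‖ ≤
        (eVariationOn γ (Set.Icc 0 1)).toReal := by
      rw [← ENNReal.ofReal_le_iff_le_toReal hV,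
        ENNReal.ofReal_sum_of_nonneg (fun _ _ => norm_nonneg _)]
      refine le_trans (le_of_eq ?_) hs
      refine Finset.sum_congr rfl fun i _ => ?_
      rw [edist_dist, Subtype.dist_eq, dist_eq_norm]
    have ht := angle_le_sum (fun i => (γ (u i) : E3)) (fun i => hn _) (n + 1)
    have u0 : u 0 = 0 := by simp [u]
    have u1 : u (n + 1) = 1 := by simp [u, div_self hN.ne']
    simp only [u0, u1] at ht
    refine le_trans (mul_le_mul_of_nonneg_left ht (by linarith)) (le_trans ?_ hs2)
    rw [Finset.mul_sum]
    refine Finset.sum_le_sum fun i _ => ?_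
    refine angle_local _ _ (hn _) (hn _) ε hε hε1 ?_
    have := H _ (hus (i+1)) _ (hus i) (hstep i)
    rw [Subtype.dist_eq, dist_eq_norm] at this
    exact this.le
  have h0 := InnerProductGeometry.angle_nonneg (γ 0 : E3) (γ 1)
  have h1 := InnerProductGeometry.angle_le_pi (γ 0 : E3) (γ 1)
  refine le_of_forall_pos_le_add fun η hη => ?_
  have hp := Real.pi_lt_four
  have hk := key (min (η / 4) 1) (by positivity) (min_le_right _ _)
  have := min_le_left (η / 4) 1
  have h3 : 0 ≤ min (η / 4) 1 := by positivity
  nlinarith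

lemma exists_frame (p q : E3) (hp : ‖p‖ = 1) (hq : ‖q‖ = 1) :
    ∃ e : E3, ‖e‖ = 1 ∧ ⟪p, e⟫ = 0 ∧
      q = Real.cos (InnerProductGeometry.angle p q) • p + Real.sin (InnerProductGeometry.angle p q) • e := by
  have hc : Real.cos (InnerProductGeometry.angle p q) = ⟪p, q⟫ := by
    rw [InnerProductGeometry.cos_angle, hp, hq]; simp
  have hsc := Real.sin_sq_add_cos_sq (InnerProductGeometry.angle p q)
  set s := Real.sin (InnerProductGeometry.angle p q)
  set c := Real.cos (InnerProductGeometry.angle p q)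
  have hw : ‖q - c • p‖ ^ 2 = s ^ 2 := by
    rw [norm_sub_sq_real, norm_smul, inner_smul_right, real_inner_comm, ← hc, hp, hq]
    simp; nlinarith
  by_cases hs : s = 0
  · have hz : q - c • p = 0 := by
      rw [hs] at hw; simpa using hw
    haveI : Fact (Module.finrank ℝ E3 = 2 + 1) := ⟨by simp⟩
    have hp0 : p ≠ 0 := by rintro rfl; simp at hp
    have hf := Submodule.finrank_orthogonal_span_singleton (𝕜 := ℝ) (n := 2) hp0
    haveI : Nontrivial (Submodule.span ℝ {p})ᗮ := Module.nontrivial_of_finrank_pos (R := ℝ) (by omega)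
    obtain ⟨⟨v, hv⟩, hv0⟩ := exists_ne (0 : (Submodule.span ℝ {p})ᗮ)
    have hv0' : v ≠ 0 := fun h => hv0 (by ext1; exact h)
    have hpv : ⟪p, v⟫ = 0 := Submodule.mem_orthogonal_singleton_iff_inner_right.1 hv
    refine ⟨‖v‖⁻¹ • v, ?_, ?_, ?_⟩
    · rw [norm_smul, norm_inv, norm_norm, inv_mul_cancel₀ (norm_ne_zero_iff.2 hv0')]
    · rw [inner_smul_right, hpv, mul_zero]
    · rw [hs, zero_smul, add_zero]; exact sub_eq_zero.1 hz
  · refine ⟨s⁻¹ • (q - c • p), ?_, ?_, ?_⟩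
    · rw [← sq_eq_sq₀ (norm_nonneg _) zero_le_one, norm_smul, mul_pow, hw, norm_inv, inv_pow]
      rw [Real.norm_eq_abs, sq_abs]; field_simp
    · rw [inner_smul_right, inner_sub_right, inner_smul_right, real_inner_self_eq_norm_sq, hp, hc]
      simp
    · rw [smul_inv_smul₀ hs]; abel

lemma upper (p q : E3) (hp : ‖p‖ = 1) (hq : ‖q‖ = 1) :
    ∃ γ : ℝ → Metric.sphere (0 : E3) 1, ContinuousOn γ (Set.Icc 0 1) ∧ (γ 0 : E3) = p ∧
      (γ 1 : E3) = q ∧ eVariationOn γ (Set.Icc 0 1) ≤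
        ENNReal.ofReal (InnerProductGeometry.angle p q) := by
  obtain ⟨e, he, hpe, hqe⟩ := exists_frame p q hp hq
  set θ := InnerProductGeometry.angle p q
  have h0 : 0 ≤ θ := InnerProductGeometry.angle_nonneg p q
  have hN : ∀ a b : ℝ, ‖a • p + b • e‖ ^ 2 = a ^ 2 + b ^ 2 := by
    intro a b
    rw [norm_add_sq_real, norm_smul, norm_smul, inner_smul_left, inner_smul_right, hpe, hp, he]
    simp
  let g : ℝ → E3 := fun t => Real.cos (θ * t) • p + Real.sin (θ * t) • e
  have hg : ∀ t, g t ∈ Metric.sphere (0 : E3) 1 := by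
    intro t
    rw [mem_sphere_zero_iff_norm, ← sq_eq_sq₀ (norm_nonneg _) zero_le_one, hN]
    simp
  let γ : ℝ → Metric.sphere (0 : E3) 1 := fun t => ⟨g t, hg t⟩
  have hL : LipschitzWith θ.toNNReal γ := by
    refine LipschitzWith.of_dist_le_mul fun s t => ?_
    rw [Subtype.dist_eq, dist_eq_norm, Real.coe_toNNReal _ h0, Real.dist_eq]
    have e1 : g s - g t = (Real.cos (θ * s) - Real.cos (θ * t)) • p +
        (Real.sin (θ * s) - Real.sin (θ * t)) • e := by
      simp only [g, sub_smul]; abel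
    change ‖g s - g t‖ ≤ _
    rw [← sq_le_sq₀ (norm_nonneg _) (by positivity), e1, hN, mul_pow, sq_abs]
    have h1 := Real.one_sub_sq_div_two_le_cos (x := θ * s - θ * t)
    rw [Real.cos_sub] at h1
    nlinarith [Real.sin_sq_add_cos_sq (θ * s), Real.sin_sq_add_cos_sq (θ * t)]
  refine ⟨γ, hL.continuous.continuousOn, ?_, ?_, ?_⟩
  · simp [γ, g]
  · simp only [γ, g, mul_one]; exact hqe.symm
  · have := (hL.lipschitzOnWith (s := Set.univ)).comp_eVariationOn_le
      (f := γ) (g := (id : ℝ → ℝ)) (s := Set.Icc (0:ℝ) 1) (fun _ _ => trivial)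
    rw [eVariationOn_id_Icc] at this
    simpa [ENNReal.ofReal] using this

/-- great-circle distance on the sphere.  For unit vectors `p, q` in
`ℝ³`, the infimum over continuous curves `γ : [0,1] → S²` joining `p` to `q` of the
total variation `eVariationOn γ [0,1]` equals `arccos ⟨p, q⟩`. -/
theorem stmt_14 (p q : EuclideanSpace ℝ (Fin 3)) (hp : ‖p‖ = 1) (hq : ‖q‖ = 1) :
    (⨅ (γ : ℝ → (Metric.sphere (0 : EuclideanSpace ℝ (Fin 3)) 1))
        (_ : ContinuousOn γ (Set.Icc 0 1))
        (_ : (γ 0 : EuclideanSpace ℝ (Fin 3)) = p)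
        (_ : (γ 1 : EuclideanSpace ℝ (Fin 3)) = q),
        eVariationOn γ (Set.Icc 0 1)) =
      ENNReal.ofReal (Real.arccos ⟪p, q⟫) := by
  have ha : Real.arccos ⟪p, q⟫ = InnerProductGeometry.angle p q := by
    rw [InnerProductGeometry.angle, hp, hq]; simp
  rw [ha]
  apply le_antisymm
  · obtain ⟨γ, h1, h2, h3, h4⟩ := upper p q hp hq
    exact iInf_le_of_le γ (iInf_le_of_le h1 (iInf_le_of_le h2 (iInf_le_of_le h3 h4)))
  · refine le_iInf fun γ => le_iInf fun h1 => le_iInf fun h2 => le_iInf fun h3 => ?_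
    have := lower γ h1
    rwa [h2, h3] at this
end
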